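/- Let Φ be a random power-law k-SAT formula with n variables, m ∈ Ω(n) clauses, k ≥ 3, and power-law exponent β > (2k−2)/(k−2), with Δ = m/n large enough so that Φ is unsatisfiable with at least constant probability. For any constant ε with 0 < ε < (k/2 − 1)(β−2)/(β−1) − 1 and Δ ∈ o(n^ε/log^ε n), asymptotically almost surely Φ has resolution width Ω(n · Δ^{−1/ε}). -/

import Mathlib

open Filter Finset

namespace PLSAT

/-- Weight of variable `i` (0-indexed): variable `i+1` has weight `(i+1)^{-1/(β-1)}`. -/
noncomputable def wt (β : ℝ) {n : ℕ} (i : Fin n) : ℝ :=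
  ((i : ℕ) + 1 : ℝ) ^ (-(1 : ℝ) / (β - 1))

noncomputable def totalWt (β : ℝ) (n : ℕ) : ℝ := ∑ i : Fin n, wt β i

/-- A sampled clause: an ordered tuple of `k` variables together with their signs. -/
abbrev Draw (n k : ℕ) := (Fin k → Fin n) × (Fin k → Bool)

/-- A sampled formula: `m` independently sampled clauses. -/
abbrev Formula (n m k : ℕ) := Fin m → Draw n k

/-- Probability mass of one sampled clause: the `k` distinct variables are drawn
without replacement with probabilities proportional to their weights, and each of
the `k` signs is chosen independently uniformly at random. -/
noncomputable def clauseMass (β : ℝ) {n : ℕ} (k : ℕ) (c : Draw n k) : ℝ :=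
  if Function.Injective c.1 then
    (1 / 2) ^ k *
      ∏ j : Fin k,
        wt β (c.1 j) /
          (totalWt β n - ∑ l ∈ Finset.univ.filter (fun l : Fin k => l < j), wt β (c.1 l))
  else 0

/-- Probability mass of a formula: clauses are sampled independently. -/
noncomputable def mass (β : ℝ) {n m k : ℕ} (φ : Formula n m k) : ℝ :=
  ∏ i : Fin m, clauseMass β k (φ i)

/-- Probability of an event in the power-law random `k`-SAT model. -/
noncomputable def Pr (β : ℝ) (n m k : ℕ) (E : Set (Formula n m k)) : ℝ :=
  ∑ φ : Formula n m k, E.indicator (mass β) φ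

def Satisfies {n k : ℕ} (a : Fin n → Bool) (c : Draw n k) : Prop :=
  ∃ j : Fin k, a (c.1 j) = c.2 j

def Unsat {n m k : ℕ} (φ : Formula n m k) : Prop :=
  ¬ ∃ a : Fin n → Bool, ∀ i : Fin m, Satisfies a (φ i)

/-- A resolution clause: a finite set of literals. -/
abbrev RClause (n : ℕ) := Finset (Fin n × Bool)

def toRClause {n k : ℕ} (c : Draw n k) : RClause n :=
  Finset.image (fun j => (c.1 j, c.2 j)) Finset.univ

def cnf {n m k : ℕ} (φ : Formula n m k) : Set (RClause n) :=
  Set.range fun i : Fin m => toRClause (φ i)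

/-- `C` is obtained by resolving `A` and `B` on some variable. -/
def IsResolvent {n : ℕ} (A B C : RClause n) : Prop :=
  ∃ x : Fin n, (x, true) ∈ A ∧ (x, false) ∈ B ∧
    C = A.erase (x, true) ∪ B.erase (x, false)

/-- `L` is a resolution refutation of the clause set `S`. -/
def IsRefutation {n : ℕ} (S : Set (RClause n)) (L : List (RClause n)) : Prop :=
  (∀ i : Fin L.length, L.get i ∈ S ∨
      ∃ j l : Fin L.length, (j : ℕ) < (i : ℕ) ∧ (l : ℕ) < (i : ℕ) ∧
        IsResolvent (L.get j) (L.get l) (L.get i)) ∧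
  (∅ : RClause n) ∈ L

def HasRefutationOfWidth {n : ℕ} (S : Set (RClause n)) (w : ℕ) : Prop :=
  ∃ L : List (RClause n), IsRefutation S L ∧ ∀ C ∈ L, C.card ≤ w

/-- The resolution width of `φ` is at least `b`: every resolution refutation
contains a clause of size at least `b`. -/
def widthAtLeast {n m k : ℕ} (b : ℝ) (φ : Formula n m k) : Prop :=
  ∀ w : ℕ, HasRefutationOfWidth (cnf φ) w → b ≤ (w : ℝ)

/-- Tree-like resolution derivations: `TreeDeriv S C s` holds if there is a tree-like
resolution derivation of clause `C` from the clause set `S` with `s` nodes. -/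
inductive TreeDeriv {n : ℕ} (S : Set (RClause n)) : RClause n → ℕ → Prop
  | ax : ∀ C ∈ S, TreeDeriv S C 1
  | res : ∀ (A B C : RClause n) (sa sb : ℕ), IsResolvent A B C →
      TreeDeriv S A sa → TreeDeriv S B sb → TreeDeriv S C (sa + sb + 1)

/-- The neighborhood of a set of clauses in the clause-variable incidence graph. -/
def nbhd {n m k : ℕ} (φ : Formula n m k) (Cs : Finset (Fin m)) : Finset (Fin n) :=
  Cs.biUnion fun i => Finset.image (φ i).1 Finset.univ

/-- `G(φ)` is an `(r, c)`-bipartite expander. -/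
def IsBipartiteExpander {n m k : ℕ} (φ : Formula n m k) (r : ℕ) (c : ℝ) : Prop :=
  ∀ Cs : Finset (Fin m), Cs.card ≤ r → (1 + c) * (Cs.card : ℝ) ≤ ((nbhd φ Cs).card : ℝ)

/-- The variables occurring in exactly one clause of `Cs`. -/
def uniqueVars {n m k : ℕ} (φ : Formula n m k) (Cs : Finset (Fin m)) : Finset (Fin n) :=
  (nbhd φ Cs).filter fun v =>
    (Cs.filter fun i => v ∈ Finset.image (φ i).1 Finset.univ).card = 1

/-- The clauses of `φ` indexed by `Cs` semantically imply the clause `C`. -/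
def Implies {n m k : ℕ} (φ : Formula n m k) (Cs : Finset (Fin m)) (C : RClause n) : Prop :=
  ∀ a : Fin n → Bool, (∀ i ∈ Cs, Satisfies a (φ i)) → ∃ l ∈ C, a l.1 = l.2

/-- If the clauses of `Cs` satisfy Hall's condition outside of `V`, then any partial assignment
on `V` extends to an assignment satisfying `Cs`. -/
lemma exists_extension_of_hall {n m k : ℕ} (φ : Formula n m k) (Cs : Finset (Fin m))
    (V : Finset (Fin n)) (a₀ : Fin n → Bool)
    (h : ∀ T ⊆ Cs, T.card ≤ (nbhd φ T \ V).card) :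
    ∃ a : Fin n → Bool, (∀ v ∈ V, a v = a₀ v) ∧ ∀ i ∈ Cs, Satisfies a (φ i) := by
  classical
  let t : {i // i ∈ Cs} → Finset (Fin n) := fun i => Finset.image (φ i).1 Finset.univ \ V
  have hall : ∀ s : Finset {i // i ∈ Cs}, s.card ≤ (s.biUnion t).card := by
    intro s
    have h1 := h (s.image Subtype.val) (by
      intro i hi
      obtain ⟨j, -, rfl⟩ := Finset.mem_image.1 hi
      exact j.2)
    rw [Finset.card_image_of_injective _ Subtype.val_injective] at h1
    refine h1.trans (Finset.card_le_card ?_)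
    intro v hv
    simp only [nbhd, Finset.mem_sdiff, Finset.mem_biUnion, Finset.mem_image, t] at hv ⊢
    obtain ⟨⟨i, ⟨j, hj, rfl⟩, hx⟩, hV⟩ := hv
    exact ⟨j, hj, hx, hV⟩
  obtain ⟨f, hinj, hf⟩ := (Finset.all_card_le_biUnion_card_iff_exists_injective t).1 hall
  have hf' : ∀ i : {i // i ∈ Cs}, ∃ j : Fin k, (φ i).1 j = f i := by
    intro i
    have := hf i
    simp only [t, Finset.mem_sdiff, Finset.mem_image, Finset.mem_univ, true_and] at this
    exact this.1
  choose g hg using hf'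
  refine ⟨fun v => if hv : ∃ i, f i = v then (φ hv.choose).2 (g hv.choose) else a₀ v, ?_, ?_⟩
  · intro v hv
    have : ¬ ∃ i, f i = v := by
      rintro ⟨i, rfl⟩
      have := hf i
      simp only [t, Finset.mem_sdiff] at this
      exact this.2 hv
    simp only [dif_neg this]
  · intro i hi
    refine ⟨g ⟨i, hi⟩, ?_⟩
    have he : ∃ i', f i' = (φ i).1 (g ⟨i, hi⟩) := ⟨⟨i, hi⟩, (hg ⟨i, hi⟩).symm⟩
    have h2 : he.choose = ⟨i, hi⟩ := hinj (he.choose_spec.trans (hg ⟨i, hi⟩))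
    simp only [dif_pos he]
    rw [h2]

lemma Satisfies.congr {n m k : ℕ} {φ : Formula n m k} {Cs : Finset (Fin m)} {a a' : Fin n → Bool}
    (h : ∀ v ∈ nbhd φ Cs, a' v = a v) {i : Fin m} (hi : i ∈ Cs) (hs : Satisfies a (φ i)) :
    Satisfies a' (φ i) := by
  obtain ⟨j, hj⟩ := hs
  refine ⟨j, (h _ ?_).trans hj⟩
  exact Finset.mem_biUnion.2 ⟨i, hi, Finset.mem_image_of_mem _ (Finset.mem_univ _)⟩

/-- A relative version of Tarsi's lemma: a set of clauses minimally implying `C` has at most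
`|Cs| + |C|` variables. -/
lemma card_nbhd_le_of_minimal {n m k : ℕ} (φ : Formula n m k) (Cs : Finset (Fin m))
    (C : RClause n) (himp : Implies φ Cs C) (hmin : ∀ T ⊂ Cs, ¬ Implies φ T C) :
    (nbhd φ Cs).card ≤ Cs.card + C.card := by
  classical
  set VC : Finset (Fin n) := C.image Prod.fst with hVC
  let f : Finset (Fin m) → ℤ := fun S => (S.card : ℤ) - ((nbhd φ S \ VC).card : ℤ)
  obtain ⟨S, hS, hmax⟩ := Finset.exists_max_image Cs.powerset f ⟨∅, by simp⟩
  rw [Finset.mem_powerset] at hS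
  by_cases hSC : S = Cs
  · have h0 := hmax ∅ (by simp)
    simp only [f, nbhd, Finset.card_empty, Finset.biUnion_empty, Finset.empty_sdiff] at h0
    rw [hSC] at h0
    have h1 : (nbhd φ Cs).card ≤ (nbhd φ Cs \ VC).card + VC.card := by
      have := Finset.le_card_sdiff VC (nbhd φ Cs)
      omega
    have h2 : VC.card ≤ C.card := Finset.card_image_le
    unfold nbhd at h1 ⊢
    omega
  · exfalso
    have hnot := hmin S (hS.ssubset_of_ne hSC)
    unfold Implies at hnot
    push Not at hnot
    obtain ⟨a₀, hsat, hfalse⟩ := hnot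
    obtain ⟨a, ha, hsat'⟩ := exists_extension_of_hall φ (Cs \ S) (VC ∪ nbhd φ S) a₀ (by
      intro T hT
      have hdisj : Disjoint S T :=
        Finset.disjoint_left.2 fun x hx hx' => (Finset.mem_sdiff.1 (hT hx')).2 hx
      have h1 := hmax (S ∪ T) (Finset.mem_powerset.2
        (Finset.union_subset hS (hT.trans Finset.sdiff_subset)))
      simp only [f, Finset.card_union_of_disjoint hdisj] at h1
      have h2 : nbhd φ (S ∪ T) \ VC = (nbhd φ S \ VC) ∪ (nbhd φ T \ (VC ∪ nbhd φ S)) := by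
        have : nbhd φ (S ∪ T) = nbhd φ S ∪ nbhd φ T := by
          unfold nbhd; exact Finset.union_biUnion
        rw [this]
        ext v
        simp only [Finset.mem_sdiff, Finset.mem_union]
        tauto
      have h3 := Finset.card_union_le (nbhd φ S \ VC) (nbhd φ T \ (VC ∪ nbhd φ S))
      rw [← h2] at h3
      push_cast at h1
      omega)
    obtain ⟨l, hl, hal⟩ := himp a (by
      intro i hi
      by_cases hiS : i ∈ S
      · exact (hsat i hiS).congr (fun v hv => ha v (Finset.mem_union_right _ hv)) hiS
      · exact hsat' i (Finset.mem_sdiff.2 ⟨hi, hiS⟩))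
    refine hfalse l hl ?_
    rw [← ha l.1 (Finset.mem_union_left _ (Finset.mem_image_of_mem _ hl))]
    exact hal

lemma exists_minimal_implies {n m k : ℕ} (φ : Formula n m k) (Cs : Finset (Fin m))
    (C : RClause n) (himp : Implies φ Cs C) :
    ∃ T ⊆ Cs, Implies φ T C ∧ ∀ T' ⊂ T, ¬ Implies φ T' C := by
  obtain ⟨T, hT, hT'⟩ := exists_minimal_le_of_wellFoundedLT (fun T => Implies φ T C) Cs himp
  exact ⟨T, hT, hT'.1, fun T' h1 h2 => h1.not_ge (hT'.2 h2 h1.le)⟩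

lemma Implies.resolvent {n m k : ℕ} {φ : Formula n m k} {Cs Ds : Finset (Fin m)}
    {A B C : RClause n} (hA : Implies φ Cs A) (hB : Implies φ Ds B) (h : IsResolvent A B C) :
    Implies φ (Cs ∪ Ds) C := by
  intro a ha
  obtain ⟨x, -, -, rfl⟩ := h
  obtain ⟨l, hl, hal⟩ := hA a fun i hi => ha i (Finset.mem_union_left _ hi)
  obtain ⟨l', hl', hal'⟩ := hB a fun i hi => ha i (Finset.mem_union_right _ hi)
  by_cases h1 : l = (x, true)
  · by_cases h2 : l' = (x, false)
    · subst h1 h2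
      simp_all
    · exact ⟨l', Finset.mem_union_right _ (Finset.mem_erase.2 ⟨h2, hl'⟩), hal'⟩
  · exact ⟨l, Finset.mem_union_left _ (Finset.mem_erase.2 ⟨h1, hl⟩), hal⟩

/-- Bipartite expansion up to size `R` forces resolution width at least `c * R / 2`. -/
theorem widthAtLeast_of_expansion {n m k : ℕ} (φ : Formula n m k) {R c : ℝ} (hR : 2 ≤ R)
    (hc : 0 < c) (hexp : ∀ Cs : Finset (Fin m), (Cs.card : ℝ) ≤ R →
      (1 + c) * (Cs.card : ℝ) ≤ ((nbhd φ Cs).card : ℝ)) :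
    widthAtLeast (c * R / 2) φ := by
  classical
  rintro w ⟨L, ⟨hL, hempty⟩, hw⟩
  by_contra! hlt
  have key : ∀ i : ℕ, ∀ hi : i < L.length, ∃ T : Finset (Fin m), (T.card : ℝ) ≤ R / 2 ∧
      Implies φ T (L.get ⟨i, hi⟩) := by
    intro i
    induction i using Nat.strong_induction_on with
    | _ i ih =>
      intro hi
      rcases hL ⟨i, hi⟩ with hS | ⟨j, l, hj, hl, hres⟩
      · obtain ⟨q, hq⟩ := hS
        refine ⟨{q}, by simp; linarith, ?_⟩
        intro a ha
        obtain ⟨p, hp⟩ := ha q (Finset.mem_singleton_self q)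
        refine ⟨((φ q).1 p, (φ q).2 p), ?_, hp⟩
        rw [← hq]
        exact Finset.mem_image_of_mem _ (Finset.mem_univ p)
      · obtain ⟨T₁, hc₁, hi₁⟩ := ih j hj j.2
        obtain ⟨T₂, hc₂, hi₂⟩ := ih l hl l.2
        obtain ⟨T, hTs, hT, hmin⟩ := exists_minimal_implies φ _ _ (hi₁.resolvent hi₂ hres)
        refine ⟨T, ?_, hT⟩
        have hTR : (T.card : ℝ) ≤ R := by
          have h1 : T.card ≤ T₁.card + T₂.card :=
            (Finset.card_le_card hTs).trans (Finset.card_union_le _ _)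
          have : (T.card : ℝ) ≤ T₁.card + T₂.card := by exact_mod_cast h1
          linarith
        have h2 := hexp T hTR
        have h3 : ((nbhd φ T).card : ℝ) ≤ T.card + (L.get ⟨i, hi⟩).card := by
          exact_mod_cast card_nbhd_le_of_minimal φ T _ hT hmin
        have h4 : ((L.get ⟨i, hi⟩).card : ℝ) ≤ w := by
          exact_mod_cast hw _ (List.get_mem _ _)
        have : c * (T.card : ℝ) < c * (R / 2) := by linarith
        exact (lt_of_mul_lt_mul_left this hc.le).le
  obtain ⟨i, hi⟩ := List.get_of_mem hempty
  obtain ⟨T, hTR, hT⟩ := key i i.2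
  obtain ⟨a, -, ha⟩ := exists_extension_of_hall φ T ∅ (fun _ => true) (by
    intro T' hT'
    rw [Finset.sdiff_empty]
    have h1 : (T'.card : ℝ) ≤ T.card := by exact_mod_cast Finset.card_le_card hT'
    have h2 := hexp T' (by linarith)
    have h3 : (0 : ℝ) ≤ c * T'.card := by positivity
    have : (T'.card : ℝ) ≤ (nbhd φ T').card := by linarith
    exact_mod_cast this)
  obtain ⟨l, hl, -⟩ := hT a ha
  rw [hi] at hl
  simp at hl

lemma sum_lt_le {n k : ℕ} {w : Fin n → ℝ} (h0 : ∀ v, 0 ≤ w v) (h1 : ∀ v, w v ≤ 1)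
    (f : Fin k → Fin n) (s : Finset (Fin k)) : ∑ l ∈ s, w (f l) ≤ k := by
  calc ∑ l ∈ s, w (f l) ≤ ∑ l, w (f l) :=
        Finset.sum_le_sum_of_subset_of_nonneg (Finset.subset_univ s) fun _ _ _ => h0 _
    _ ≤ ∑ _l : Fin k, (1 : ℝ) := Finset.sum_le_sum fun _ _ => h1 _
    _ = k := by simp

/-- Weighted sampling without replacement defines a probability distribution. -/
lemma sum_sampling_without_replacement {n : ℕ} {w : Fin n → ℝ} (h0 : ∀ v, 0 ≤ w v)
    (h1 : ∀ v, w v ≤ 1) (k : ℕ) (hk : (k : ℝ) < ∑ v, w v) :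
    ∑ f : Fin k → Fin n, (if Function.Injective f then
      ∏ j : Fin k, w (f j) / (∑ v, w v - ∑ l ∈ Finset.univ.filter (fun l : Fin k => l < j), w (f l))
      else 0) = 1 := by
  classical
  set W := ∑ v, w v with hW
  induction k with
  | zero => simp [Function.injective_of_subsingleton]
  | succ k ih =>
    have hk' : (k : ℝ) < W := by push_cast at hk; linarith
    rw [← (Fin.snocEquiv (fun _ => Fin n)).sum_comp, Fintype.sum_prod_type, Finset.sum_comm,
      ← ih hk']
    refine Finset.sum_congr rfl fun p _ => ?_
    simp only [Fin.snocEquiv, Equiv.coe_fn_mk, Fin.snoc_injective_iff]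
    by_cases hp : Function.Injective p
    · simp only [hp, true_and, if_true, Fin.prod_univ_castSucc, Fin.snoc_castSucc, Fin.snoc_last,
        Finset.sum_filter, Fin.sum_univ_castSucc, Fin.castSucc_lt_castSucc_iff,
        Fin.castSucc_lt_last, not_lt_of_ge (Fin.le_last _), if_false, add_zero]
      simp only [← Finset.sum_filter, ← mul_ite_zero]
      rw [← Finset.mul_sum]
      simp only [← Finset.sum_filter]
      rw [← Finset.sum_div]
      have h2 : ∑ l, w (p l) = ∑ v ∈ Finset.univ.image p, w v :=
        (Finset.sum_image fun _ _ _ _ h => hp h).symm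
      have h3 : ∑ v ∈ Finset.univ.filter (fun x => x ∉ Set.range p), w v = W - ∑ l, w (p l) := by
        rw [h2, hW, eq_sub_iff_add_eq,
          ← Finset.sum_filter_add_sum_filter_not Finset.univ (fun x => x ∉ Set.range p) w]
        congr 2
        ext v
        simp
      have h4 := sum_lt_le h0 h1 p Finset.univ
      rw [h3, div_self (by linarith), mul_one]
    · simp [hp]

/-- If the total weight is at least `2 * k`, all denominators occurring when sampling `k` variables
without replacement are at least half of the total weight. -/
lemma half_le_denominator {n k : ℕ} {w : Fin n → ℝ} (h0 : ∀ v, 0 ≤ w v) (h1 : ∀ v, w v ≤ 1)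
    (hk : 2 * (k : ℝ) ≤ ∑ v, w v) (f : Fin k → Fin n) (s : Finset (Fin k)) :
    (∑ v, w v) / 2 ≤ ∑ v, w v - ∑ l ∈ s, w (f l) := by
  have := sum_lt_le h0 h1 f s
  linarith

lemma wt_pos (β : ℝ) {n : ℕ} (v : Fin n) : 0 < wt β v := by
  unfold wt; positivity

lemma wt_le_one {β : ℝ} (hβ : 1 < β) {n : ℕ} (v : Fin n) : wt β v ≤ 1 := by
  unfold wt
  refine Real.rpow_le_one_of_one_le_of_nonpos (by simp) ?_
  rw [neg_div]
  exact neg_nonpos.2 (div_nonneg zero_le_one (by linarith))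

section Probability

variable {β : ℝ} {n k : ℕ}

lemma sum_bool_half (k : ℕ) : ∑ _b : Fin k → Bool, ((1 : ℝ) / 2) ^ k = 1 := by
  simp [Finset.card_univ]

lemma clauseMass_nonneg (hβ : 1 < β) (hk : 2 * (k : ℝ) ≤ totalWt β n) (c : Draw n k) :
    0 ≤ clauseMass β k c := by
  unfold clauseMass
  split_ifs
  · refine mul_nonneg (by positivity) (Finset.prod_nonneg fun j _ => div_nonneg (wt_pos β _).le ?_)
    refine le_trans ?_ (half_le_denominator (fun v => (wt_pos β v).le) (wt_le_one hβ) hk c.1 _)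
    have : (0 : ℝ) ≤ k := k.cast_nonneg
    unfold totalWt at hk
    linarith
  · exact le_rfl

lemma sum_clauseMass (hβ : 1 < β) (hk1 : 1 ≤ k) (hk : 2 * (k : ℝ) ≤ totalWt β n) :
    ∑ c : Draw n k, clauseMass β k c = 1 := by
  have hk1' : (1 : ℝ) ≤ k := by exact_mod_cast hk1
  rw [← sum_sampling_without_replacement (fun v => (wt_pos β v).le) (wt_le_one hβ) k
    (by unfold totalWt at hk; linarith), Fintype.sum_prod_type]
  refine Finset.sum_congr rfl fun f _ => ?_
  simp only [clauseMass]
  split_ifs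
  · rw [← Finset.sum_mul, sum_bool_half, one_mul]
    rfl
  · simp

/-- The probability that a random clause has all its variables in `S`. -/
noncomputable def clauseInside (β : ℝ) (k : ℕ) (S : Finset (Fin n)) : ℝ :=
  ∑ c : Draw n k, {c : Draw n k | ∀ j, c.1 j ∈ S}.indicator (clauseMass β k) c

lemma clauseInside_le (hβ : 1 < β) (hk1 : 1 ≤ k) (hk : 2 * (k : ℝ) ≤ totalWt β n)
    (S : Finset (Fin n)) :
    clauseInside β k S ≤ (2 * (∑ v ∈ S, wt β v) / totalWt β n) ^ k := by
  classical
  have hk1' : (1 : ℝ) ≤ k := by exact_mod_cast hk1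
  have hW : 0 < totalWt β n := by linarith
  have hrhs : (2 * (∑ v ∈ S, wt β v) / totalWt β n) ^ k =
      ∑ f ∈ Fintype.piFinset (fun _ : Fin k => S), ∏ j, (wt β (f j) / (totalWt β n / 2)) := by
    rw [← Finset.sum_pow' S (fun v => wt β v / (totalWt β n / 2)) k, ← Finset.sum_div]
    congr 1
    field_simp
  rw [clauseInside, Fintype.sum_prod_type, hrhs,
    ← Finset.sum_subset (Finset.subset_univ (Fintype.piFinset (fun _ : Fin k => S)))]
  · refine Finset.sum_le_sum fun f hf => ?_
    calc _ ≤ ∑ _b : Fin k → Bool, (1 / 2 : ℝ) ^ k *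
          ∏ j, (wt β (f j) / (totalWt β n / 2)) := by
          refine Finset.sum_le_sum fun b _ => ?_
          have hP : 0 ≤ ∏ j, (wt β (f j) / (totalWt β n / 2)) :=
            Finset.prod_nonneg fun j _ => div_nonneg (wt_pos β _).le (by linarith)
          refine (Set.indicator_le_self' (fun _ _ => clauseMass_nonneg hβ hk _) _).trans ?_
          simp only [clauseMass]
          split_ifs
          · refine mul_le_mul_of_nonneg_left ?_ (by positivity)
            have hd := half_le_denominator (fun v => (wt_pos β v).le) (wt_le_one hβ) hk f
            refine Finset.prod_le_prod (fun j _ => div_nonneg (wt_pos β _).le ?_) fun j _ => ?_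
            · exact (half_pos hW).le.trans (hd _)
            · exact div_le_div_of_nonneg_left (wt_pos β _).le (half_pos hW) (hd _)
          · positivity
      _ = _ := by rw [← Finset.sum_mul, sum_bool_half, one_mul]
  · intro f _ hf
    refine Finset.sum_eq_zero fun b _ => Set.indicator_of_notMem ?_ _
    simpa [Fintype.mem_piFinset] using hf

lemma mass_nonneg (hβ : 1 < β) (hk : 2 * (k : ℝ) ≤ totalWt β n) {m : ℕ} (φ : Formula n m k) :
    0 ≤ mass β φ :=
  Finset.prod_nonneg fun _ _ => clauseMass_nonneg hβ hk _

lemma sum_mass (hβ : 1 < β) (hk1 : 1 ≤ k) (hk : 2 * (k : ℝ) ≤ totalWt β n) (m : ℕ) :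
    ∑ φ : Formula n m k, mass β φ = 1 := by
  classical
  have := Finset.prod_univ_sum (fun _ : Fin m => (Finset.univ : Finset (Draw n k)))
    (fun _ c => clauseMass β k c)
  rw [Fintype.piFinset_univ] at this
  unfold mass
  rw [← this]
  simp [sum_clauseMass hβ hk1 hk]

lemma Pr_add_Pr_compl (hβ : 1 < β) (hk1 : 1 ≤ k) (hk : 2 * (k : ℝ) ≤ totalWt β n) {m : ℕ}
    (E : Set (Formula n m k)) : Pr β n m k E + Pr β n m k Eᶜ = 1 := by
  unfold Pr
  rw [← Finset.sum_add_distrib, ← sum_mass hβ hk1 hk m]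
  refine Finset.sum_congr rfl fun φ _ => ?_
  exact Set.indicator_self_add_compl_apply E (mass β) φ

lemma Pr_nonneg (hβ : 1 < β) (hk : 2 * (k : ℝ) ≤ totalWt β n) {m : ℕ}
    (E : Set (Formula n m k)) : 0 ≤ Pr β n m k E :=
  Finset.sum_nonneg fun _ _ => Set.indicator_nonneg (fun _ _ => mass_nonneg hβ hk _) _

lemma Pr_mono (hβ : 1 < β) (hk : 2 * (k : ℝ) ≤ totalWt β n) {m : ℕ}
    {E F : Set (Formula n m k)} (h : E ⊆ F) : Pr β n m k E ≤ Pr β n m k F :=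
  Finset.sum_le_sum fun _ _ =>
    Set.indicator_le_indicator_of_subset h (fun _ => mass_nonneg hβ hk _) _

/-- Union bound. -/
lemma Pr_biUnion_le (hβ : 1 < β) (hk : 2 * (k : ℝ) ≤ totalWt β n) {m : ℕ} {ι : Type*}
    (A : Finset ι) (F : ι → Set (Formula n m k)) :
    Pr β n m k (⋃ a ∈ A, F a) ≤ ∑ a ∈ A, Pr β n m k (F a) := by
  classical
  unfold Pr
  rw [Finset.sum_comm]
  refine Finset.sum_le_sum fun φ _ => ?_
  by_cases hφ : φ ∈ ⋃ a ∈ A, F a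
  · rw [Set.indicator_of_mem hφ]
    simp only [Set.mem_iUnion] at hφ
    obtain ⟨a, ha, hφa⟩ := hφ
    calc mass β φ = (F a).indicator (mass β) φ := (Set.indicator_of_mem hφa _).symm
      _ ≤ _ := Finset.single_le_sum (f := fun a => (F a).indicator (mass β) φ)
        (fun _ _ => Set.indicator_nonneg (fun _ _ => mass_nonneg hβ hk _) _) ha
  · rw [Set.indicator_of_notMem hφ]
    exact Finset.sum_nonneg fun _ _ => Set.indicator_nonneg (fun _ _ => mass_nonneg hβ hk _) _

/-- Independence: all clauses of `Cs` live on `S` with probability `clauseInside ^ |Cs|`. -/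
lemma Pr_inside (hβ : 1 < β) (hk1 : 1 ≤ k) (hk : 2 * (k : ℝ) ≤ totalWt β n) {m : ℕ}
    (Cs : Finset (Fin m)) (S : Finset (Fin n)) :
    Pr β n m k {φ | ∀ i ∈ Cs, ∀ j, (φ i).1 j ∈ S} = clauseInside β k S ^ Cs.card := by
  classical
  let g : Fin m → Draw n k → ℝ := fun i => if i ∈ Cs then
    {c : Draw n k | ∀ j, c.1 j ∈ S}.indicator (clauseMass β k) else clauseMass β k
  have h1 : ∀ φ : Formula n m k,
      {φ : Formula n m k | ∀ i ∈ Cs, ∀ j, (φ i).1 j ∈ S}.indicator (mass β) φ =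
        ∏ i, g i (φ i) := by
    intro φ
    by_cases hφ : ∀ i ∈ Cs, ∀ j, (φ i).1 j ∈ S
    · rw [Set.indicator_of_mem (by exact hφ)]
      refine Finset.prod_congr rfl fun i _ => ?_
      by_cases hi : i ∈ Cs
      · simp only [g, hi, if_true]
        rw [Set.indicator_of_mem (by exact hφ i hi)]
      · simp only [g, hi, if_false]
    · rw [Set.indicator_of_notMem (by exact hφ)]
      push Not at hφ
      obtain ⟨i, hi, j, hj⟩ := hφ
      symm
      refine Finset.prod_eq_zero (Finset.mem_univ i) ?_
      simp only [g, hi, if_true]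
      exact Set.indicator_of_notMem (s := {c : Draw n k | ∀ j, c.1 j ∈ S}) (fun h => hj (h j)) _
  have h2 := Finset.prod_univ_sum (fun _ : Fin m => (Finset.univ : Finset (Draw n k))) g
  rw [Fintype.piFinset_univ] at h2
  unfold Pr
  rw [Finset.sum_congr rfl fun φ _ => h1 φ, ← h2]
  have h3 : ∀ i, ∑ c, g i c = if i ∈ Cs then clauseInside β k S else 1 := by
    intro i
    by_cases hi : i ∈ Cs
    · simp only [g, hi, if_true, clauseInside]
    · simp only [g, hi, if_false, sum_clauseMass hβ hk1 hk]
  rw [Finset.prod_congr rfl fun i _ => h3 i]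
  simp

end Probability

lemma wt_eq_rpow {β : ℝ} (hβ : 1 < β) {n : ℕ} (v : Fin n) :
    wt β v = ((v : ℕ) + 1 : ℝ) ^ ((β - 2) / (β - 1) - 1) := by
  unfold wt
  congr 1
  have : β - 1 ≠ 0 := by linarith
  field_simp
  ring

lemma rpow_add_le_succ_rpow {α : ℝ} (h0 : 0 ≤ α) (h1 : α ≤ 1) (t : ℕ) :
    (t : ℝ) ^ α + α * ((t : ℝ) + 1) ^ (α - 1) ≤ ((t : ℝ) + 1) ^ α := by
  have ht : (0 : ℝ) < (t : ℝ) + 1 := by positivity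
  have hb := rpow_one_add_le_one_add_mul_self (s := -(1 / ((t : ℝ) + 1)))
    (by
      rw [neg_le_neg_iff, div_le_one ht]
      linarith [t.cast_nonneg (α := ℝ)]) h0 h1
  have he : 1 + -(1 / ((t : ℝ) + 1)) = t / (t + 1) := by field_simp; ring
  rw [he, Real.div_rpow t.cast_nonneg ht.le, div_le_iff₀ (by positivity)] at hb
  rw [Real.rpow_sub_one ht.ne']
  calc _ ≤ (1 + α * -(1 / ((t : ℝ) + 1))) * ((t : ℝ) + 1) ^ α +
        α * (((t : ℝ) + 1) ^ α / (t + 1)) := by gcongr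
    _ = _ := by field_simp; ring

/-- The heaviest `s` variables have total weight at most `s ^ α / α`. -/
lemma sum_wt_le {β : ℝ} (hβ : 2 < β) {n : ℕ} (S : Finset (Fin n)) :
    ∑ v ∈ S, wt β v ≤ (S.card : ℝ) ^ ((β - 2) / (β - 1)) / ((β - 2) / (β - 1)) := by
  classical
  set α := (β - 2) / (β - 1) with hα
  have hα0 : 0 < α := div_pos (by linarith) (by linarith)
  have hα1 : α ≤ 1 := (div_le_one (by linarith)).2 (by linarith)
  induction S using Finset.induction_on_max with
  | empty => simp [Real.zero_rpow hα0.ne']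
  | insert a S hmax ih =>
    have ha : a ∉ S := fun h => lt_irrefl _ (hmax a h)
    have hcard : S.card ≤ (a : ℕ) := by
      have : S ⊆ Finset.Iio a := fun x hx => Finset.mem_Iio.2 (hmax x hx)
      simpa using Finset.card_le_card this
    rw [Finset.sum_insert ha, Finset.card_insert_of_notMem ha, wt_eq_rpow (by linarith)]
    have hcard' : (S.card : ℝ) ≤ (a : ℕ) := by exact_mod_cast hcard
    have h1 : ((a : ℕ) + 1 : ℝ) ^ (α - 1) ≤ ((S.card : ℝ) + 1) ^ (α - 1) :=
      Real.rpow_le_rpow_of_nonpos (by positivity) (by linarith) (by linarith)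
    have h2 := rpow_add_le_succ_rpow hα0.le hα1 S.card
    rw [le_div_iff₀ hα0] at ih ⊢
    push_cast
    nlinarith

lemma rpow_le_totalWt {β : ℝ} (hβ : 2 < β) (n : ℕ) :
    (n : ℝ) ^ ((β - 2) / (β - 1)) ≤ totalWt β n := by
  set α := (β - 2) / (β - 1) with hα
  have hα1 : α ≤ 1 := (div_le_one (by linarith)).2 (by linarith)
  have hα0 : 0 < α := div_pos (by linarith) (by linarith)
  rcases Nat.eq_zero_or_pos n with rfl | hn
  · simp [totalWt, Real.zero_rpow hα0.ne']
  have hn' : (0 : ℝ) < n := by exact_mod_cast hn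
  calc (n : ℝ) ^ α = ∑ _v : Fin n, (n : ℝ) ^ (α - 1) := by
        rw [Finset.sum_const, Finset.card_univ, Fintype.card_fin, nsmul_eq_mul,
          Real.rpow_sub_one hn'.ne']
        field_simp
    _ ≤ totalWt β n := Finset.sum_le_sum fun v _ => by
        rw [wt_eq_rpow (by linarith)]
        refine Real.rpow_le_rpow_of_nonpos (by positivity) ?_ (by linarith)
        exact_mod_cast v.2

/-- Union bound over all small non-expanding sets of clauses. -/
lemma Pr_not_widthAtLeast_le {β : ℝ} (hβ : 2 < β) {n k m : ℕ} (hk1 : 1 ≤ k)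
    (hk : 2 * (k : ℝ) ≤ totalWt β n) (hn : 0 < n) {R c : ℝ} (hR : 2 ≤ R) (hc : 0 < c)
    (hRn : (1 + c) * R ≤ n) :
    Pr β n m k {φ | widthAtLeast (c * R / 2) φ}ᶜ ≤ ∑ i ∈ Finset.Icc 1 ⌊R⌋₊,
      (m.choose i : ℝ) * (n.choose ⌊(1 + c) * i⌋₊) *
        ((2 * (((⌊(1 + c) * i⌋₊ : ℕ) : ℝ) ^ ((β - 2) / (β - 1)) / ((β - 2) / (β - 1))) /
          (n : ℝ) ^ ((β - 2) / (β - 1))) ^ k) ^ i := by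
  classical
  set α := (β - 2) / (β - 1) with hα
  have hβ1 : 1 < β := by linarith
  have hα0 : 0 < α := div_pos (by linarith) (by linarith)
  let s : ℕ → ℕ := fun i => ⌊(1 + c) * i⌋₊
  let A : ℕ → Finset (Finset (Fin m) × Finset (Fin n)) := fun i =>
    Finset.powersetCard i Finset.univ ×ˢ Finset.powersetCard (s i) Finset.univ
  let F : Finset (Fin m) × Finset (Fin n) → Set (Formula n m k) := fun p =>
    {φ | ∀ i ∈ p.1, ∀ j, (φ i).1 j ∈ p.2}
  have hsub : {φ : Formula n m k | widthAtLeast (c * R / 2) φ}ᶜ ⊆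
      ⋃ i ∈ Finset.Icc 1 ⌊R⌋₊, ⋃ p ∈ A i, F p := by
    intro φ hφ
    by_contra hnot
    refine hφ (widthAtLeast_of_expansion φ hR hc ?_)
    intro Cs hCs
    by_contra! hlt
    apply hnot
    have hpos : 1 ≤ Cs.card := by
      by_contra h0
      have h0 : Cs = ∅ := Finset.card_eq_zero.1 (by omega)
      subst h0
      simp at hlt
      have : (0 : ℝ) ≤ ((nbhd φ ∅).card : ℝ) := by positivity
      linarith
    have hs1 : (nbhd φ Cs).card ≤ s Cs.card := Nat.le_floor hlt.le
    have hs2 : s Cs.card ≤ n := by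
      refine Nat.floor_le_of_le (le_trans ?_ hRn)
      gcongr
    obtain ⟨S, hS, hScard⟩ := Finset.exists_superset_card_eq hs1 (by simpa using hs2)
    simp only [Set.mem_iUnion]
    refine ⟨Cs.card, Finset.mem_Icc.2 ⟨hpos, Nat.le_floor hCs⟩, (Cs, S), ?_, ?_⟩
    · simp [A, Finset.mem_powersetCard, hScard]
    · intro i hi j
      exact hS (Finset.mem_biUnion.2 ⟨i, hi, Finset.mem_image_of_mem _ (Finset.mem_univ j)⟩)
  refine (Pr_mono hβ1 hk hsub).trans ((Pr_biUnion_le hβ1 hk _ _).trans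
    (Finset.sum_le_sum fun i hi => (Pr_biUnion_le hβ1 hk _ _).trans ?_))
  have hn' : (0 : ℝ) < (n : ℝ) ^ α := Real.rpow_pos_of_pos (by exact_mod_cast hn) _
  calc ∑ p ∈ A i, Pr β n m k (F p) ≤ ∑ _p ∈ A i,
        ((2 * (((s i : ℕ) : ℝ) ^ α / α) / (n : ℝ) ^ α) ^ k) ^ i := by
        refine Finset.sum_le_sum fun p hp => ?_
        simp only [A, Finset.mem_product, Finset.mem_powersetCard] at hp
        rw [Pr_inside hβ1 hk1 hk, hp.1.2]
        have hin : 0 ≤ clauseInside β k p.2 :=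
          Finset.sum_nonneg fun _ _ => Set.indicator_nonneg
            (fun _ _ => clauseMass_nonneg hβ1 hk _) _
        refine pow_le_pow_left₀ hin ((clauseInside_le hβ1 hk1 hk _).trans ?_) _
        have hw : 0 ≤ ∑ v ∈ p.2, wt β v := Finset.sum_nonneg fun v _ => (wt_pos β v).le
        have h1 := sum_wt_le hβ p.2
        have h2 := rpow_le_totalWt hβ n
        rw [hp.2.2, ← hα] at h1
        have hW : 0 ≤ totalWt β n := hn'.le.trans h2
        refine pow_le_pow_left₀ (div_nonneg (by linarith) hW) ?_ _
        exact div_le_div₀ (by positivity) (by linarith) hn' h2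
    _ = _ := by
        rw [Finset.sum_const, nsmul_eq_mul]
        simp [A, s]

lemma choose_le_exp_mul_div_pow (a : ℕ) {b : ℕ} (hb : 0 < b) :
    (a.choose b : ℝ) ≤ (Real.exp 1 * a / b) ^ b := by
  have hb' : (0 : ℝ) < b := by exact_mod_cast hb
  have h1 : (a.choose b : ℝ) ≤ (a : ℝ) ^ b / b.factorial := Nat.choose_le_pow_div b a
  have h2 : (b : ℝ) ^ b / b.factorial ≤ Real.exp b := Real.pow_div_factorial_le_exp b hb'.le b
  have hf : (0 : ℝ) < b.factorial := by exact_mod_cast b.factorial_pos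
  refine h1.trans ?_
  rw [div_pow, mul_pow, ← Real.exp_nat_mul, mul_one, div_le_div_iff₀ hf (by positivity)]
  rw [div_le_iff₀ hf] at h2
  have : (0 : ℝ) ≤ (a : ℝ) ^ b := by positivity
  nlinarith

/-- Each term of the union bound is the `i`-th power of `K Δ (i / n) ^ (α k - 2 - c)`. -/
lemma union_bound_term_le {n m k i : ℕ} {α c : ℝ} (hα0 : 0 < α) (hα1 : α ≤ 1) (hc0 : 0 < c)
    (hc1 : c ≤ 1) (hi : 0 < i) (hin : i ≤ n) :
    (m.choose i : ℝ) * (n.choose ⌊(1 + c) * i⌋₊) *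
        ((2 * (((⌊(1 + c) * i⌋₊ : ℕ) : ℝ) ^ α / α) / (n : ℝ) ^ α) ^ k) ^ i ≤
      ((Real.exp 1) ^ 3 * (4 / α) ^ k * ((m : ℝ) / n) * ((i : ℝ) / n) ^ (α * k - 2 - c)) ^ i := by
  have hi' : (0 : ℝ) < i := by exact_mod_cast hi
  have hin' : (i : ℝ) ≤ n := by exact_mod_cast hin
  have hn' : (0 : ℝ) < n := hi'.trans_le hin'
  set s := ⌊(1 + c) * (i : ℝ)⌋₊ with hs
  set x : ℝ := (i : ℝ) / n with hx
  set e := Real.exp 1 with he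
  have he1 : 1 ≤ e := Real.one_le_exp zero_le_one
  have hx0 : 0 < x := div_pos hi' hn'
  have hx1 : x ≤ 1 := (div_le_one hn').2 hin'
  have hsi : i ≤ s := Nat.le_floor (by nlinarith)
  have hs1 : (s : ℝ) ≤ (1 + c) * i := Nat.floor_le (by positivity)
  have hA : (m.choose i : ℝ) ≤ (e * ((m : ℝ) / n) * x⁻¹) ^ i := by
    refine (choose_le_exp_mul_div_pow m hi).trans_eq ?_
    congr 1
    rw [hx, he]
    field_simp
  have hB : (n.choose s : ℝ) ≤ (e ^ 2 * x ^ (-(1 + c))) ^ i := by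
    have hex : 1 ≤ e * x⁻¹ := one_le_mul_of_one_le_of_one_le he1 ((one_le_inv₀ hx0).2 hx1)
    calc (n.choose s : ℝ) ≤ (e * n / s) ^ s := choose_le_exp_mul_div_pow n (hi.trans_le hsi)
      _ ≤ (e * x⁻¹) ^ s := by
        refine pow_le_pow_left₀ (by positivity) ?_ _
        rw [hx, inv_div, mul_div_assoc]
        gcongr
      _ = (e * x⁻¹) ^ (s : ℝ) := (Real.rpow_natCast _ _).symm
      _ ≤ (e * x⁻¹) ^ ((1 + c) * (i : ℝ)) := Real.rpow_le_rpow_of_exponent_le hex hs1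
      _ = ((e * x⁻¹) ^ (1 + c)) ^ i := by rw [Real.rpow_mul (by positivity), Real.rpow_natCast]
      _ ≤ (e ^ 2 * x ^ (-(1 + c))) ^ i := by
        refine pow_le_pow_left₀ (by positivity) ?_ _
        rw [Real.mul_rpow (by positivity) (by positivity), Real.rpow_neg hx0.le,
          Real.inv_rpow hx0.le]
        gcongr
        rw [← Real.rpow_natCast]
        exact Real.rpow_le_rpow_of_exponent_le he1 (by push_cast; linarith)
  have hC : (2 * ((s : ℝ) ^ α / α) / (n : ℝ) ^ α) ^ k ≤ (4 / α) ^ k * x ^ (α * k) := by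
    rw [Real.rpow_mul hx0.le, Real.rpow_natCast, ← mul_pow]
    refine pow_le_pow_left₀ (by positivity) ?_ _
    have h2 : (s : ℝ) ^ α ≤ 2 * (i : ℝ) ^ α := by
      calc (s : ℝ) ^ α ≤ (2 * (i : ℝ)) ^ α := by
            refine Real.rpow_le_rpow (by positivity) ?_ hα0.le
            nlinarith
        _ = 2 ^ α * (i : ℝ) ^ α := Real.mul_rpow (by norm_num) hi'.le
        _ ≤ 2 ^ (1 : ℝ) * (i : ℝ) ^ α := by
            gcongr
            norm_num
        _ = _ := by rw [Real.rpow_one]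
    rw [hx, Real.div_rpow hi'.le hn'.le]
    calc 2 * ((s : ℝ) ^ α / α) / (n : ℝ) ^ α ≤ 2 * ((2 * (i : ℝ) ^ α) / α) / (n : ℝ) ^ α := by
          gcongr
      _ = _ := by ring
  have hexp : x ^ (α * k - 2 - c) = x⁻¹ * x ^ (-(1 + c)) * x ^ (α * k) := by
    rw [← Real.rpow_neg_one, ← Real.rpow_add hx0, ← Real.rpow_add hx0]
    congr 1
    ring
  calc _ ≤ (e * ((m : ℝ) / n) * x⁻¹) ^ i * (e ^ 2 * x ^ (-(1 + c))) ^ i *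
        ((4 / α) ^ k * x ^ (α * k)) ^ i := by
        gcongr
    _ = _ := by
        rw [hexp, ← mul_pow, ← mul_pow]
        congr 1
        ring

/-- With `i` up to a small multiple of `n Δ ^ (-1/ε)`, the union bound terms decay geometrically. -/
lemma union_bound_term_le_geometric {n i : ℕ} {K Δ γ ε c C₁ : ℝ} (hK : 0 < K) (hΔ : 0 < Δ)
    (hε : 0 < ε) (hc0 : 0 < c) (hc1 : c ≤ 1) (hγ : ε + c ≤ γ) (hC₁ : 0 < C₁)
    (hKC : K * C₁ ^ ε ≤ 1 / 2) (hi : 0 < i) (hin : i ≤ n)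
    (hiR : (i : ℝ) ≤ C₁ * (n * Δ ^ (-1 / ε))) :
    (K * Δ * ((i : ℝ) / n) ^ γ) ^ i ≤ (n : ℝ) ^ (-c) * (i * (1 / 2) ^ i) := by
  have hi' : (0 : ℝ) < i := by exact_mod_cast hi
  have hi1 : (1 : ℝ) ≤ i := by exact_mod_cast hi
  have hin' : (i : ℝ) ≤ n := by exact_mod_cast hin
  have hn' : (0 : ℝ) < n := hi'.trans_le hin'
  set x : ℝ := (i : ℝ) / n with hx
  have hx0 : 0 < x := div_pos hi' hn'
  have hx1 : x ≤ 1 := (div_le_one hn').2 hin'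
  have hxc1 : x ^ c ≤ 1 := Real.rpow_le_one hx0.le hx1 hc0.le
  have hxε : Δ * x ^ ε ≤ C₁ ^ ε := by
    have h1 : x ≤ C₁ * Δ ^ (-1 / ε) := by
      rw [hx, div_le_iff₀ hn']
      linarith
    calc Δ * x ^ ε ≤ Δ * (C₁ * Δ ^ (-1 / ε)) ^ ε := by gcongr
      _ = C₁ ^ ε := by
        rw [Real.mul_rpow hC₁.le (by positivity), ← Real.rpow_mul hΔ.le,
          div_mul_cancel₀ _ hε.ne', Real.rpow_neg_one]
        field_simp
  have hbase : K * Δ * x ^ γ ≤ 1 / 2 * x ^ c := by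
    calc K * Δ * x ^ γ ≤ K * Δ * x ^ (ε + c) := by
          refine mul_le_mul_of_nonneg_left ?_ (by positivity)
          exact Real.rpow_le_rpow_of_exponent_ge hx0 hx1 hγ
      _ = K * (Δ * x ^ ε) * x ^ c := by rw [Real.rpow_add hx0]; ring
      _ ≤ K * C₁ ^ ε * x ^ c := by gcongr
      _ ≤ _ := by gcongr
  calc (K * Δ * x ^ γ) ^ i ≤ (1 / 2 * x ^ c) ^ i := pow_le_pow_left₀ (by positivity) hbase _
    _ = (1 / 2) ^ i * (x ^ c) ^ i := mul_pow _ _ _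
    _ ≤ (1 / 2) ^ i * x ^ c := by
        gcongr
        exact pow_le_of_le_one (by positivity) hxc1 hi.ne'
    _ ≤ (1 / 2) ^ i * (i * (n : ℝ) ^ (-c)) := by
        gcongr
        rw [hx, Real.div_rpow hi'.le hn'.le, Real.rpow_neg hn'.le, div_eq_mul_inv]
        gcongr
        calc (i : ℝ) ^ c ≤ (i : ℝ) ^ (1 : ℝ) := Real.rpow_le_rpow_of_exponent_le hi1 hc1
          _ = i := Real.rpow_one _
    _ = _ := by ring

lemma sum_mul_half_pow_le (s : Finset ℕ) : ∑ i ∈ s, (i : ℝ) * (1 / 2) ^ i ≤ 2 := by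
  have h := hasSum_coe_mul_geometric_of_norm_lt_one (𝕜 := ℝ) (r := 1 / 2) (by norm_num)
  rw [show (1 / 2 : ℝ) / (1 - 1 / 2) ^ 2 = 2 by norm_num] at h
  exact sum_le_hasSum s (fun i _ => by positivity) h

/-- If `Δ = O((n / log n) ^ ε)`, then `n Δ ^ (-1/ε)` is at least `log n`. -/
lemma log_le_mul_rpow {n : ℕ} (hn : 2 ≤ n) {Δ ε : ℝ} (hΔ : 0 < Δ) (hε : 0 < ε)
    (h : Δ ≤ (n : ℝ) ^ ε / Real.log n ^ ε) : Real.log n ≤ n * Δ ^ (-1 / ε) := by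
  have hn1 : (1 : ℝ) < n := by exact_mod_cast hn
  have hn0 : (0 : ℝ) < n := by linarith
  have hl : 0 < Real.log n := Real.log_pos hn1
  rw [← Real.div_rpow hn0.le hl.le] at h
  have h1 := Real.rpow_le_rpow_of_nonpos hΔ h
    (show -1 / ε ≤ 0 from div_nonpos_of_nonpos_of_nonneg (by norm_num) hε.le)
  rw [← Real.rpow_mul (by positivity), mul_div_cancel₀ _ hε.ne', Real.rpow_neg_one, inv_div,
    div_le_iff₀ hn0] at h1
  linarith

end PLSAT

open PLSAT in
/-- **Resolution width lower bound via bipartite expansion (Corollary 5.8).**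
For a random power-law `k`-SAT formula with `m ∈ Ω(n)` clauses, `k ≥ 3`,
`β > (2k-2)/(k-2)`, density `Δ = m/n` large enough for unsatisfiability with
constant probability, any constant `0 < ε < (k/2 - 1)(β-2)/(β-1) - 1` and
`Δ ∈ o(n^ε / log^ε n)`, asymptotically almost surely the resolution width is
`Ω(n · Δ^{-1/ε})`. -/
theorem power_law_resolution_width_via_expansion
    (k : ℕ) (hk : 3 ≤ k) (β : ℝ)
    (hβ : (2 * (k : ℝ) - 2) / ((k : ℝ) - 2) < β)
    (m : ℕ → ℕ)
    (hm : ∃ c > (0 : ℝ), ∀ᶠ n : ℕ in atTop, c * (n : ℝ) ≤ (m n : ℝ))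
    (Δ : ℕ → ℝ) (hΔ : ∀ n : ℕ, Δ n = (m n : ℝ) / (n : ℝ))
    (hunsat : ∃ c > (0 : ℝ), ∀ᶠ n : ℕ in atTop,
      c ≤ Pr β n (m n) k {φ | Unsat φ})
    (ε : ℝ) (hε : 0 < ε)
    (hεub : ε < ((k : ℝ) / 2 - 1) * (β - 2) / (β - 1) - 1)
    (hΔo : Δ =o[atTop] fun n : ℕ => (n : ℝ) ^ ε / Real.log n ^ ε) :
    ∃ C > (0 : ℝ), Tendsto (fun n : ℕ => Pr β n (m n) k
        {φ | widthAtLeast (C * ((n : ℝ) * Δ n ^ (-1 / ε))) φ})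
      atTop (nhds 1) := by
  have hk3 : (3 : ℝ) ≤ k := by exact_mod_cast hk
  have hβ2 : 2 < β := by
    refine lt_of_le_of_lt ?_ hβ
    rw [le_div_iff₀ (by linarith)]
    linarith
  set α := (β - 2) / (β - 1) with hα
  have hα0 : 0 < α := div_pos (by linarith) (by linarith)
  have hα1 : α ≤ 1 := (div_le_one (by linarith)).2 (by linarith)
  have hgap : 0 < α * k - 2 - ε := by
    rw [mul_div_assoc, ← hα] at hεub
    nlinarith
  obtain ⟨c₀, hc₀, hm⟩ := hm
  set c : ℝ := min 1 ((α * k - 2 - ε) / 2) with hc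
  have hcpos : 0 < c := lt_min one_pos (by linarith)
  have hc1 : c ≤ 1 := min_le_left _ _
  have hc2 : c ≤ (α * k - 2 - ε) / 2 := min_le_right _ _
  set K : ℝ := Real.exp 1 ^ 3 * (4 / α) ^ k with hKdef
  have hK : 0 < K := by positivity
  set C₁ : ℝ := min ((1 / (2 * K)) ^ (1 / ε)) (c₀ ^ (1 / ε) / 2) with hC₁def
  have hC₁ : 0 < C₁ := lt_min (by positivity) (by positivity)
  have hKC : K * C₁ ^ ε ≤ 1 / 2 := by
    calc K * C₁ ^ ε ≤ K * ((1 / (2 * K)) ^ (1 / ε)) ^ ε := by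
          gcongr
          exact min_le_left _ _
      _ = 1 / 2 := by
          rw [← Real.rpow_mul (by positivity), one_div_mul_cancel hε.ne', Real.rpow_one]
          field_simp
  refine ⟨c * C₁ / 2, by positivity, ?_⟩
  have hlog : ∀ᶠ n : ℕ in atTop, 2 / C₁ ≤ Real.log n :=
    (Real.tendsto_log_atTop.comp tendsto_natCast_atTop_atTop).eventually_ge_atTop _
  have hpow : ∀ᶠ n : ℕ in atTop, 2 * (k : ℝ) ≤ (n : ℝ) ^ α :=
    ((tendsto_rpow_atTop hα0).comp tendsto_natCast_atTop_atTop).eventually_ge_atTop _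
  have hcompl : ∀ᶠ n : ℕ in atTop,
      1 - 2 * (n : ℝ) ^ (-c) ≤
          Pr β n (m n) k {φ | widthAtLeast (c * C₁ / 2 * ((n : ℝ) * Δ n ^ (-1 / ε))) φ} ∧
        Pr β n (m n) k {φ | widthAtLeast (c * C₁ / 2 * ((n : ℝ) * Δ n ^ (-1 / ε))) φ} ≤ 1 := by
    filter_upwards [hm, hlog, hpow, hΔo.bound one_pos, eventually_ge_atTop 2]
      with n hmn hlogn hpown hΔn hn2
    have hn0 : (0 : ℝ) < n := by exact_mod_cast (by omega : 0 < n)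
    have hW : 2 * (k : ℝ) ≤ totalWt β n := hpown.trans (rpow_le_totalWt hβ2 n)
    have hΔc : c₀ ≤ Δ n := by
      rw [hΔ, le_div_iff₀ hn0]
      exact hmn
    have hΔ0 : 0 < Δ n := hc₀.trans_le hΔc
    have hlog0 : 0 ≤ Real.log n := Real.log_natCast_nonneg n
    rw [Real.norm_of_nonneg hΔ0.le, one_mul, Real.norm_of_nonneg (by positivity)] at hΔn
    set R : ℝ := C₁ * ((n : ℝ) * Δ n ^ (-1 / ε)) with hR
    have hR2 : 2 ≤ R := by
      have h1 := log_le_mul_rpow hn2 hΔ0 hε hΔn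
      rw [div_le_iff₀ hC₁] at hlogn
      nlinarith
    have hRn : R ≤ n / 2 := by
      have h1 : Δ n ^ (-1 / ε) ≤ c₀ ^ (-1 / ε) :=
        Real.rpow_le_rpow_of_nonpos hc₀ hΔc
          (div_nonpos_of_nonpos_of_nonneg (by norm_num) hε.le)
      calc R ≤ c₀ ^ (1 / ε) / 2 * (n * c₀ ^ (-1 / ε)) := by
            rw [hR]
            gcongr
            exact min_le_right _ _
        _ = c₀ ^ (1 / ε) * c₀ ^ (-1 / ε) * (n / 2) := by ring
        _ = n / 2 := by
            rw [← Real.rpow_add hc₀, ← add_div]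
            simp
    rw [show c * C₁ / 2 * ((n : ℝ) * Δ n ^ (-1 / ε)) = c * R / 2 by rw [hR]; ring]
    have hk1 : 1 ≤ k := by omega
    have hβ1 : 1 < β := by linarith
    have hsum := Pr_add_Pr_compl hβ1 hk1 hW {φ : Formula n (m n) k | widthAtLeast (c * R / 2) φ}
    refine ⟨?_, ?_⟩
    · have hbad := Pr_not_widthAtLeast_le (m := m n) hβ2 hk1 hW (by omega) hR2 hcpos (by nlinarith)
      have hterms : ∀ i ∈ Finset.Icc 1 ⌊R⌋₊,
          ((m n).choose i : ℝ) * (n.choose ⌊(1 + c) * i⌋₊) *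
            ((2 * (((⌊(1 + c) * i⌋₊ : ℕ) : ℝ) ^ α / α) / (n : ℝ) ^ α) ^ k) ^ i ≤
          (n : ℝ) ^ (-c) * (i * (1 / 2) ^ i) := by
        intro i hi
        rw [Finset.mem_Icc] at hi
        have hiR : (i : ℝ) ≤ R := (Nat.le_floor_iff (by linarith)).1 hi.2
        have hin : i ≤ n := by
          have : (i : ℝ) ≤ n := by linarith
          exact_mod_cast this
        refine (union_bound_term_le hα0 hα1 hcpos hc1 hi.1 hin).trans ?_
        rw [← hΔ]
        exact union_bound_term_le_geometric hK hΔ0 hε hcpos hc1 (by linarith) hC₁ hKC hi.1 hin hiR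
      have h1 := hbad.trans (Finset.sum_le_sum hterms)
      rw [← Finset.mul_sum] at h1
      have h2 := mul_le_mul_of_nonneg_left (sum_mul_half_pow_le (Finset.Icc 1 ⌊R⌋₊))
        (Real.rpow_nonneg hn0.le (-c))
      linarith
    · have := Pr_nonneg hβ1 hW {φ : Formula n (m n) k | widthAtLeast (c * R / 2) φ}ᶜ
      linarith
  have hlim : Tendsto (fun n : ℕ => 1 - 2 * (n : ℝ) ^ (-c)) atTop (nhds 1) := by
    have h := ((tendsto_rpow_neg_atTop hcpos).comp tendsto_natCast_atTop_atTop).const_mul (2 : ℝ)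
    simpa using h.const_sub (1 : ℝ)
  exact tendsto_of_tendsto_of_tendsto_of_le_of_le' hlim tendsto_const_nhds
    (hcompl.mono fun n hn => hn.1) (hcompl.mono fun n hn => hn.2)
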